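/- arXiv:2506.08463 — 2 statements merged into one kernel-verified Lean document; each statement's English description precedes it below -/
import Mathlib

section
/- Consider a finite deterministic episodic MDP with behavior policy β satisfying the no-tie condition: for every h and all τ¹, τ² ∈ T_β with s_h(τ¹) = s_h(τ²) and a_h(τ¹) ≠ a_h(τ²), one has g_h(τ¹) ≠ g_h(τ²). Assume P_β(g_h(τ) = f*(s,h) | s_h(τ) = s) ≥ c̃ > 0 for all (s,h) ∈ dom(f*), let d_min^β = min{d_h^β(s) : d_h^β(s) > 0}, and fix α ∈ (1 − c̃/2, 1). Given a dataset D of N i.i.d. trajectories from P_β, let f̂*(s,h) be the empirical α-quantile of the multiset {g_h(τ^k) : s_h(τ^k) = s}, let π̂(a|s,h,g) be the empirical conditional frequency of action a among dataset stage-h visits with s_h = s and g_h = g, and let π̂*_D(·|s,h) = π̂(·|s,h,f̂*(s,h)). If N ≥ max{(2/(d_min^β)²)·log(2SH/δ), (4/(c̃²·d_min^β))·log(2SH/δ)}, then with probability at least 1 − δ over the dataset, J(π*_β) = J(π̂*_D). -/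
open Finset

namespace RCSL

noncomputable section

/-- Real-valued indicator of a proposition. -/
def ind (P : Prop) : ℝ :=
  haveI := Classical.propDecidable P
  if P then 1 else 0

/-- A finite deterministic episodic MDP with horizon `H`.  Stages are 0-indexed
(`0, …, H-1` here corresponds to the paper's stages `1, …, H`). -/
structure DetMDP (S A : Type) [Fintype S] [Fintype A] (H : ℕ) where
  /-- deterministic transition function -/
  step : ℕ → S → A → S
  /-- deterministic reward function -/
  r : ℕ → S → A → ℝ
  r_nonneg : ∀ h s a, 0 ≤ r h s a
  r_le_one : ∀ h s a, r h s a ≤ 1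
  /-- initial state distribution -/
  ρ : S → ℝ
  ρ_nonneg : ∀ s, 0 ≤ ρ s
  ρ_sum_one : ∑ s, ρ s = 1

/-- Stagewise weight functions on actions; genuine policies are those satisfying `IsPolicy`. -/
abbrev Pol (S A : Type) := ℕ → S → A → ℝ

variable {S A : Type} [Fintype S] [Fintype A] [Nonempty S] [Nonempty A] {H : ℕ}

/-- `π` is a genuine stagewise policy: at every stage and state it is a
probability distribution on actions. -/
def IsPolicy (π : Pol S A) : Prop :=
  (∀ h s a, 0 ≤ π h s a) ∧ ∀ h s, ∑ a, π h s a = 1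

/-- Length-`H` trajectories: a state–action pair at every stage. -/
abbrev Traj (S A : Type) (H : ℕ) := Fin H → S × A

/-- The state of trajectory `τ` at (0-indexed) stage `h`. -/
def stAt (τ : Traj S A H) (h : ℕ) : S :=
  if hh : h < H then (τ ⟨h, hh⟩).1 else Classical.arbitrary S

/-- The action of trajectory `τ` at (0-indexed) stage `h`. -/
def actAt (τ : Traj S A H) (h : ℕ) : A :=
  if hh : h < H then (τ ⟨h, hh⟩).2 else Classical.arbitrary A

/-- The probability `P_β(τ)` of trajectory `τ` when the initial state is drawn from `ρ`,
actions are drawn from the policy `β`, and states follow the deterministic dynamics. -/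
def trajProb (M : DetMDP S A H) (β : Pol S A) (τ : Traj S A H) : ℝ :=
  (if 0 < H then M.ρ (stAt τ 0) else 1) *
    (∏ h : Fin H, β h (stAt τ h) (actAt τ h)) *
    ∏ h : Fin H, (if (h : ℕ) + 1 < H then
      ind (stAt τ ((h : ℕ) + 1) = M.step h (stAt τ h) (actAt τ h)) else 1)

/-- The return-to-go `g_h(τ) = Σ_{t ≥ h} r_t(s_t, a_t)` of trajectory `τ` from stage `h`. -/
def rtg (M : DetMDP S A H) (h : ℕ) (τ : Traj S A H) : ℝ :=
  ∑ t : Fin H, if h ≤ (t : ℕ) then M.r t (stAt τ t) (actAt τ t) else 0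

/-- The stage-`h` state occupancy measure `d_h^π` of policy `π`. -/
def occ (M : DetMDP S A H) (π : Pol S A) : ℕ → S → ℝ
  | 0 => M.ρ
  | n + 1 => fun s' => ∑ s, ∑ a, occ M π n s * π n s a * ind (M.step n s a = s')

/-- The expected total reward `J(π)` of policy `π`. -/
def J (M : DetMDP S A H) (π : Pol S A) : ℝ :=
  ∑ h ∈ Finset.range H, ∑ s, ∑ a, occ M π h s * π h s a * M.r h s a

/-- The conditional action probability `P_β(a_h = a ∣ s_h = s, g_h = g)`. -/
def condA (M : DetMDP S A H) (β : Pol S A) (h : ℕ) (s : S) (g : ℝ) (a : A) : ℝ :=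
  (∑ τ : Traj S A H, trajProb M β τ * ind (stAt τ h = s ∧ actAt τ h = a ∧ rtg M h τ = g)) /
    ∑ τ : Traj S A H, trajProb M β τ * ind (stAt τ h = s ∧ rtg M h τ = g)

/-- The in-distribution optimal return-to-go `f⋆(s, h)`: the largest return-to-go at `(s, h)`
along trajectories that are feasible under the behavior policy `β`. -/
def fstar (M : DetMDP S A H) (β : Pol S A) (s : S) (h : ℕ) : ℝ :=
  sSup {g : ℝ | ∃ τ : Traj S A H, 0 < trajProb M β τ ∧ stAt τ h = s ∧ rtg M h τ = g}

/-- The return-conditioned policy `π_f(a ∣ s, h) = P_β(a_h = a ∣ s_h = s, g_h = f(s, h))`. -/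
def rcPolicy (M : DetMDP S A H) (β : Pol S A) (f : S → ℕ → ℝ) : Pol S A :=
  fun h s a => condA M β h s (f s h) a

/-- The in-distribution optimal stitched policy `π⋆_β = π_{f⋆}`. -/
def piStar (M : DetMDP S A H) (β : Pol S A) : Pol S A :=
  rcPolicy M β fun s h => fstar M β s h

/-- Probability that an i.i.d. dataset of `N` trajectories drawn from `P_β` satisfies `E`. -/
def datasetProb (M : DetMDP S A H) (β : Pol S A) (N : ℕ)
    (E : (Fin N → Traj S A H) → Prop) : ℝ :=
  ∑ D : Fin N → Traj S A H, (∏ k, trajProb M β (D k)) * ind (E D)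

/-- `f` (with domain `dom ⊆ S × {0, …, H-1}`) is a feasible conditioning function
(`f ∈ F_β`). -/
def IsFeasibleCond (M : DetMDP S A H) (β : Pol S A) (f : S → ℕ → ℝ)
    (dom : Set (S × ℕ)) : Prop :=
  ∀ p ∈ dom, p.2 < H ∧
    ∃ τ : Traj S A H, 0 < trajProb M β τ ∧ stAt τ p.2 = p.1 ∧ rtg M p.2 τ = f p.1 p.2

/-- `f` is a consistent feasible conditioning function (`f ∈ F^Cst_β`): its domain contains
`(s, 0)` for every initial state `s` in the support of `ρ`, the conditioned initial return
occurs with positive probability under `β` from `s`, and along every trajectory generated by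
`π_f` one has `f(s_h, h) = r_h(s_h, a_h) + f(s_{h+1}, h+1)` (with the convention that the
term `f(s_{H+1}, H+1)` beyond the horizon is `0`). -/
def IsConsistentCond (M : DetMDP S A H) (β : Pol S A) (f : S → ℕ → ℝ)
    (dom : Set (S × ℕ)) : Prop :=
  IsFeasibleCond M β f dom ∧
    (∀ s, 0 < M.ρ s → (s, 0) ∈ dom) ∧
    (∀ s, 0 < M.ρ s →
      ∃ τ : Traj S A H, 0 < trajProb M β τ ∧ stAt τ 0 = s ∧ rtg M 0 τ = f s 0) ∧
    ∀ τ : Traj S A H, 0 < trajProb M (rcPolicy M β f) τ → ∀ h, h < H →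
      (stAt τ h, h) ∈ dom ∧
        f (stAt τ h) h = M.r h (stAt τ h) (actAt τ h) +
          (if h + 1 < H then f (stAt τ (h + 1)) (h + 1) else 0)

end

end RCSL

namespace RCSL

noncomputable section

variable {S A : Type} [Fintype S] [Fintype A] [Nonempty S] [Nonempty A] {H : ℕ}

/-- The empirical in-distribution optimal return-to-go
`f̂⋆(s, h) = max{g_h(τ^k) : τ^k ∈ D, s_h(τ^k) = s}`. -/
def fhatMax (M : DetMDP S A H) {N : ℕ} (D : Fin N → Traj S A H) (s : S) (h : ℕ) : ℝ :=
  sSup {g : ℝ | ∃ k, stAt (D k) h = s ∧ rtg M h (D k) = g}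

/-- The population loss
`L(π) = Σ_h E_{τ∼P_β}[log (P_β(a_h ∣ s_h, h, g_h) / π(a_h ∣ s_h, h, g_h))]`, i.e. the
expected Kullback–Leibler divergence `E_{(s,g)∼P_β}[KL(P_β(·∣s,g) ‖ π(·∣s,g))]` summed over
stages. -/
def popLoss (M : DetMDP S A H) (β : Pol S A) (π : ℕ → S → ℝ → A → ℝ) : ℝ :=
  ∑ h ∈ Finset.range H, ∑ τ : Traj S A H, trajProb M β τ *
    Real.log (condA M β h (stAt τ h) (rtg M h τ) (actAt τ h) /
      π h (stAt τ h) (rtg M h τ) (actAt τ h))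

/-- The empirical negative log-likelihood
`Σ_{τ ∈ D} Σ_h −log π(a_h ∣ s_h, h, g_h(τ))`. -/
def empNLL (M : DetMDP S A H) {N : ℕ} (D : Fin N → Traj S A H)
    (π : ℕ → S → ℝ → A → ℝ) : ℝ :=
  ∑ k, ∑ h ∈ Finset.range H, -Real.log (π h (stAt (D k) h) (rtg M h (D k)) (actAt (D k) h))

/-- The empirical conditional action frequency `π̂(a ∣ s, h, g)`: the fraction, among
dataset stage-`h` visits with `s_h = s` and `g_h = g`, of those whose action is `a`. -/
def empCondPolicy (M : DetMDP S A H) {N : ℕ} (D : Fin N → Traj S A H)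
    (h : ℕ) (s : S) (g : ℝ) (a : A) : ℝ :=
  (∑ k, ind (stAt (D k) h = s ∧ actAt (D k) h = a ∧ rtg M h (D k) = g)) /
    ∑ k, ind (stAt (D k) h = s ∧ rtg M h (D k) = g)

/-- `q` is an empirical `α`-quantile of the multiset `{g_h(τ^k) : s_h(τ^k) = s}` of
stage-`h` returns at state `s` in the dataset `D`. -/
def IsEmpQuantile (M : DetMDP S A H) {N : ℕ} (D : Fin N → Traj S A H)
    (α : ℝ) (s : S) (h : ℕ) (q : ℝ) : Prop :=
  α * (∑ k, ind (stAt (D k) h = s)) ≤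
      (∑ k, ind (stAt (D k) h = s ∧ rtg M h (D k) ≤ q)) ∧
    (1 - α) * (∑ k, ind (stAt (D k) h = s)) ≤
      ∑ k, ind (stAt (D k) h = s ∧ q ≤ rtg M h (D k))

end

end RCSL

namespace RCSL

section Aux

set_option linter.unusedSectionVars false

variable {S A : Type} [Fintype S] [Fintype A] [Nonempty S] [Nonempty A] {H : ℕ}

lemma ind_of {P : Prop} (h : P) : ind P = 1 := by simp [ind, h]

lemma ind_of_not {P : Prop} (h : ¬ P) : ind P = 0 := by simp [ind, h]

lemma ind_nonneg (P : Prop) : 0 ≤ ind P := by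
  by_cases h : P <;> simp [ind, h]

lemma ind_eq_ite (P : Prop) [Decidable P] : ind P = if P then 1 else 0 := by
  by_cases h : P <;> simp [ind, h]

lemma of_ind_ne_zero {P : Prop} (h : ind P ≠ 0) : P := by
  by_contra hP
  exact h (ind_of_not hP)

lemma sum_ind_eq_mul (f : S → ℝ) (x : S) : ∑ s, ind (s = x) * f s = f x := by
  classical
  simp [ind_eq_ite]

lemma sum_ind_eq (x : S) : ∑ s, ind (s = x) = 1 := by
  simpa using sum_ind_eq_mul (fun _ => 1) x

/-- The same dynamics with horizon `n`. -/
def DetMDP.restrict (M : DetMDP S A H) (n : ℕ) : DetMDP S A n :=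
  { M with }

lemma occ_restrict (M : DetMDP S A H) (n : ℕ) (π : Pol S A) (h : ℕ) :
    occ (M.restrict n) π h = occ M π h := by
  induction h with
  | zero => rfl
  | succ h ih => simp only [occ, ih]; rfl

lemma stAt_snoc_lt {n : ℕ} (τ : Traj S A n) (x : S × A) {h : ℕ} (hh : h < n) :
    stAt (Fin.snoc τ x : Traj S A (n + 1)) h = stAt τ h := by
  have h' : h < n + 1 := by omega
  simp [stAt, hh, h', Fin.snoc]

lemma actAt_snoc_lt {n : ℕ} (τ : Traj S A n) (x : S × A) {h : ℕ} (hh : h < n) :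
    actAt (Fin.snoc τ x : Traj S A (n + 1)) h = actAt τ h := by
  have h' : h < n + 1 := by omega
  simp [actAt, hh, h', Fin.snoc]

lemma stAt_snoc_last {n : ℕ} (τ : Traj S A n) (x : S × A) :
    stAt (Fin.snoc τ x : Traj S A (n + 1)) n = x.1 := by
  simp [stAt, Fin.snoc]

lemma actAt_snoc_last {n : ℕ} (τ : Traj S A n) (x : S × A) :
    actAt (Fin.snoc τ x : Traj S A (n + 1)) n = x.2 := by
  simp [actAt, Fin.snoc]

/-- Probability that the state following the prefix `τ` is `s`. -/
noncomputable def nextProb (M : DetMDP S A H) {n : ℕ} (τ : Traj S A n) (s : S) : ℝ :=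
  match n with
  | 0 => M.ρ s
  | m + 1 => ind (s = M.step m (stAt τ m) (actAt τ m))

lemma sum_nextProb (M : DetMDP S A H) {n : ℕ} (τ : Traj S A n) :
    ∑ s, nextProb M τ s = 1 := by
  cases n with
  | zero => exact M.ρ_sum_one
  | succ m => exact sum_ind_eq _

lemma trajProb_snoc (M : DetMDP S A H) (β : Pol S A) {n : ℕ} (τ : Traj S A n) (x : S × A) :
    trajProb (M.restrict (n + 1)) β (Fin.snoc τ x) =
      trajProb (M.restrict n) β τ * (nextProb M τ x.1 * β n x.1 x.2) := by
  cases n with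
  | zero =>
    simp [trajProb, nextProb, stAt_snoc_last, actAt_snoc_last, DetMDP.restrict]
  | succ m =>
    unfold trajProb
    rw [Fin.prod_univ_castSucc (n := m + 1), Fin.prod_univ_castSucc (n := m + 1),
      Fin.prod_univ_castSucc (n := m)
        (f := fun h : Fin (m + 1) => if (h.castSucc : ℕ) + 1 < m + 1 + 1 then _ else _),
      Fin.prod_univ_castSucc (n := m)
        (f := fun h : Fin (m + 1) => if (h : ℕ) + 1 < m + 1 then _ else _)]
    have e1 : ∀ h : Fin (m + 1), stAt (Fin.snoc τ x : Traj S A (m + 1 + 1)) (h : ℕ) = stAt τ h :=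
      fun h => stAt_snoc_lt τ x h.2
    have e2 : ∀ h : Fin (m + 1),
        actAt (Fin.snoc τ x : Traj S A (m + 1 + 1)) (h : ℕ) = actAt τ h :=
      fun h => actAt_snoc_lt τ x h.2
    have e3 : ∀ h : Fin m, stAt (Fin.snoc τ x : Traj S A (m + 1 + 1)) ((h : ℕ) + 1)
        = stAt τ ((h : ℕ) + 1) := fun h => stAt_snoc_lt τ x (by omega)
    have e4 : ∀ h : Fin m, stAt (Fin.snoc τ x : Traj S A (m + 1 + 1)) (h : ℕ) = stAt τ h :=
      fun h => stAt_snoc_lt τ x (by omega)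
    have e5 : ∀ h : Fin m, actAt (Fin.snoc τ x : Traj S A (m + 1 + 1)) (h : ℕ) = actAt τ h :=
      fun h => actAt_snoc_lt τ x (by omega)
    have e6 : stAt (Fin.snoc τ x : Traj S A (m + 1 + 1)) 0 = stAt τ 0 :=
      stAt_snoc_lt τ x (by omega)
    have e7 : stAt (Fin.snoc τ x : Traj S A (m + 1 + 1)) m = stAt τ m :=
      stAt_snoc_lt τ x (by omega)
    have e8 : actAt (Fin.snoc τ x : Traj S A (m + 1 + 1)) m = actAt τ m :=
      actAt_snoc_lt τ x (by omega)
    simp [e1, e2, e3, e4, e5, e6, e7, e8, stAt_snoc_last, actAt_snoc_last, nextProb,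
      DetMDP.restrict]
    ring

lemma sum_traj_succ {n : ℕ} (f : Traj S A (n + 1) → ℝ) :
    ∑ τ, f τ = ∑ τ : Traj S A n, ∑ x : S × A, f (Fin.snoc τ x) := by
  rw [← (Fin.snocEquiv (fun _ : Fin (n + 1) => S × A)).sum_comp, Fintype.sum_prod_type,
    Finset.sum_comm]
  rfl

lemma sum_nextProb_mul {β : Pol S A} (hβ : IsPolicy β) (M : DetMDP S A H) {n : ℕ}
    (τ : Traj S A n) : ∑ x : S × A, nextProb M τ x.1 * β n x.1 x.2 = 1 := by
  rw [Fintype.sum_prod_type]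
  simp only [← Finset.mul_sum, hβ.2, mul_one, sum_nextProb]

lemma sum_trajProb_restrict {β : Pol S A} (hβ : IsPolicy β) (M : DetMDP S A H) (n : ℕ) :
    ∑ τ, trajProb (M.restrict n) β τ = 1 := by
  induction n with
  | zero => simp [trajProb]
  | succ n ih =>
    rw [sum_traj_succ]
    simp only [trajProb_snoc, ← Finset.mul_sum, sum_nextProb_mul hβ, mul_one, ih]

lemma sum_trajProb {β : Pol S A} (hβ : IsPolicy β) (M : DetMDP S A H) :
    ∑ τ, trajProb M β τ = 1 :=
  sum_trajProb_restrict hβ M H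

lemma sum_trajProb_last {β : Pol S A} (M : DetMDP S A H) (n : ℕ)
    (f : S → A → ℝ) :
    ∑ τ, trajProb (M.restrict (n + 1)) β τ * f (stAt τ n) (actAt τ n) =
      ∑ s, ∑ a, occ M β n s * β n s a * f s a := by
  induction n generalizing f with
  | zero =>
    rw [sum_traj_succ]
    simp [stAt_snoc_last, actAt_snoc_last, occ, trajProb, Fintype.sum_prod_type,
      DetMDP.restrict]
  | succ n ih =>
    rw [sum_traj_succ]
    simp only [trajProb_snoc, stAt_snoc_last, actAt_snoc_last, nextProb, Fintype.sum_prod_type,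
      mul_assoc, ← Finset.mul_sum, sum_ind_eq_mul]
    have := ih (fun s a => ∑ b, β (n + 1) (M.step n s a) b * f (M.step n s a) b)
    rw [this]
    simp only [occ, Finset.sum_mul]
    symm
    rw [Finset.sum_comm]
    refine Finset.sum_congr rfl fun s _ => ?_
    rw [Finset.sum_comm]
    refine Finset.sum_congr rfl fun a _ => ?_
    have : ∀ s', occ M β n s * β n s a * ind (M.step n s a = s') *
        ∑ b, β (n + 1) s' b * f s' b = ind (s' = M.step n s a) *
          (occ M β n s * β n s a * ∑ b, β (n + 1) s' b * f s' b) := by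
      intro s'
      rw [show (M.step n s a = s') = (s' = M.step n s a) from propext eq_comm]
      ring
    simp only [this, sum_ind_eq_mul]

lemma sum_trajProb_stAt_restrict {β : Pol S A} (hβ : IsPolicy β) (M : DetMDP S A H) (h k : ℕ)
    (f : S → ℝ) :
    ∑ τ, trajProb (M.restrict (h + 1 + k)) β τ * f (stAt τ h) = ∑ s, occ M β h s * f s := by
  induction k with
  | zero =>
    have := sum_trajProb_last (β := β) M h (fun s _ => f s)
    refine this.trans ?_
    refine Finset.sum_congr rfl fun s _ => ?_
    rw [← Finset.sum_mul, ← Finset.mul_sum, hβ.2, mul_one]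
  | succ k ih =>
    rw [← ih, ← add_assoc, sum_traj_succ]
    refine Finset.sum_congr rfl fun τ _ => ?_
    have e : ∀ x, stAt (Fin.snoc τ x : Traj S A (h + 1 + k + 1)) h = stAt τ h :=
      fun x => stAt_snoc_lt τ x (by omega)
    simp only [trajProb_snoc, e, ← Finset.sum_mul, ← Finset.mul_sum, sum_nextProb_mul hβ, mul_one]

lemma sum_trajProb_ind_stAt {β : Pol S A} (hβ : IsPolicy β) (M : DetMDP S A H) {h : ℕ}
    (hh : h < H) (s : S) :
    ∑ τ, trajProb M β τ * ind (stAt τ h = s) = occ M β h s := by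
  obtain ⟨k, rfl⟩ := Nat.exists_eq_add_of_lt hh
  have := sum_trajProb_stAt_restrict hβ M h k (fun x => ind (x = s))
  rw [show h + 1 + k = h + k + 1 by omega] at this
  refine this.trans ?_
  rw [← sum_ind_eq_mul (occ M β h) s]
  exact Finset.sum_congr rfl fun x _ => mul_comm _ _

lemma trajProb_nonneg {β : Pol S A} (hβ : IsPolicy β) (M : DetMDP S A H) (τ : Traj S A H) :
    0 ≤ trajProb M β τ := by
  unfold trajProb
  refine mul_nonneg (mul_nonneg ?_ (Finset.prod_nonneg fun h _ => hβ.1 _ _ _))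
    (Finset.prod_nonneg fun h _ => ?_)
  · split_ifs
    exacts [M.ρ_nonneg _, zero_le_one]
  · split_ifs
    exacts [ind_nonneg _, zero_le_one]

lemma policy_pos_of_trajProb_pos {β : Pol S A} (hβ : IsPolicy β) (M : DetMDP S A H)
    {τ : Traj S A H} (hτ : 0 < trajProb M β τ) {h : ℕ} (hh : h < H) :
    0 < β h (stAt τ h) (actAt τ h) := by
  refine lt_of_le_of_ne (hβ.1 _ _ _) fun h0 => hτ.ne' ?_
  unfold trajProb
  rw [Finset.prod_eq_zero (f := fun h : Fin H => β h (stAt τ h) (actAt τ h))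
    (Finset.mem_univ ⟨h, hh⟩) h0.symm]
  simp

lemma occ_nonneg {β : Pol S A} (hβ : IsPolicy β) (M : DetMDP S A H) (h : ℕ) (s : S) :
    0 ≤ occ M β h s := by
  induction h generalizing s with
  | zero => exact M.ρ_nonneg s
  | succ h ih =>
    exact Finset.sum_nonneg fun x _ => Finset.sum_nonneg fun a _ =>
      mul_nonneg (mul_nonneg (ih x) (hβ.1 _ _ _)) (ind_nonneg _)

lemma rtg_le_fstar (M : DetMDP S A H) (β : Pol S A) {τ : Traj S A H}
    (hτ : 0 < trajProb M β τ) {s : S} {h : ℕ} (hs : stAt τ h = s) :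
    rtg M h τ ≤ fstar M β s h := by
  refine le_csSup ?_ ⟨τ, hτ, hs, rfl⟩
  refine ((Set.finite_range fun τ : Traj S A H => rtg M h τ).subset ?_).bddAbove
  rintro g ⟨τ, -, -, rfl⟩
  exact ⟨τ, rfl⟩

/-- Under the no-tie condition, conditioning on the state and the return-to-go determines the
action, for every weighting of feasible trajectories. -/
lemma cond_action_eq_ind {ι : Type*} [Fintype ι] (M : DetMDP S A H) (β : Pol S A) {h : ℕ}
    (hnotie : ∀ τ1 τ2 : Traj S A H, 0 < trajProb M β τ1 → 0 < trajProb M β τ2 →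
      stAt τ1 h = stAt τ2 h → actAt τ1 h ≠ actAt τ2 h → rtg M h τ1 ≠ rtg M h τ2)
    {τ₀ : Traj S A H} (hτ₀ : 0 < trajProb M β τ₀) {s : S} {g : ℝ} (hs : stAt τ₀ h = s)
    (hg : rtg M h τ₀ = g) (w : ι → ℝ) (σ : ι → Traj S A H)
    (hσ : ∀ i, w i ≠ 0 → 0 < trajProb M β (σ i))
    (hpos : 0 < ∑ i, w i * ind (stAt (σ i) h = s ∧ rtg M h (σ i) = g)) (a : A) :
    (∑ i, w i * ind (stAt (σ i) h = s ∧ actAt (σ i) h = a ∧ rtg M h (σ i) = g)) /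
      ∑ i, w i * ind (stAt (σ i) h = s ∧ rtg M h (σ i) = g) = ind (a = actAt τ₀ h) := by
  have key : ∀ i, w i * ind (stAt (σ i) h = s ∧ actAt (σ i) h = a ∧ rtg M h (σ i) = g) =
      w i * ind (stAt (σ i) h = s ∧ rtg M h (σ i) = g) * ind (a = actAt τ₀ h) := by
    intro i
    by_cases hw : w i = 0
    · simp [hw]
    by_cases hsg : stAt (σ i) h = s ∧ rtg M h (σ i) = g
    · have hact : actAt (σ i) h = actAt τ₀ h := by
        by_contra hne
        exact hnotie _ _ (hσ i hw) hτ₀ (hsg.1.trans hs.symm) hne (hsg.2.trans hg.symm)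
      by_cases ha : a = actAt τ₀ h
      · rw [ind_of hsg, ind_of ha, ind_of ⟨hsg.1, hact.trans ha.symm, hsg.2⟩]; ring
      · rw [ind_of_not ha, ind_of_not fun hc => ha (hc.2.1.symm.trans hact)]; ring
    · rw [ind_of_not hsg, ind_of_not fun hc => hsg ⟨hc.1, hc.2.2⟩]; ring
  simp only [key, ← Finset.sum_mul]
  field_simp

/-- The returns of two policies agree if, at every state visited by `β`, both are the same
deterministic choice of an action supported by `β`. -/
lemma J_congr {β : Pol S A} (hβ : IsPolicy β) (M : DetMDP S A H) (π₁ π₂ : Pol S A)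
    (hπ : ∀ h, h < H → ∀ s, 0 < occ M β h s →
      ∃ a₀, 0 < β h s a₀ ∧ ∀ a, π₁ h s a = ind (a = a₀) ∧ π₂ h s a = ind (a = a₀)) :
    J M π₁ = J M π₂ := by
  have eqm : ∀ h, h < H → ∀ s, (occ M π₁ h s = occ M π₂ h s ∧
      (occ M π₁ h s ≠ 0 → 0 < occ M β h s)) → ∀ a,
      occ M π₁ h s * π₁ h s a = occ M π₂ h s * π₂ h s a := by
    intro h hh s ⟨he, hp⟩ a
    by_cases h0 : occ M π₁ h s = 0
    · rw [← he, h0]; simp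
    · obtain ⟨a₀, -, ha⟩ := hπ h hh s (hp h0)
      rw [← he, (ha a).1, (ha a).2]
  have main : ∀ h, h < H → ∀ s, occ M π₁ h s = occ M π₂ h s ∧
      (occ M π₁ h s ≠ 0 → 0 < occ M β h s) := by
    intro h
    induction h with
    | zero =>
      exact fun _ s => ⟨rfl, fun hne => lt_of_le_of_ne (M.ρ_nonneg s) (Ne.symm hne)⟩
    | succ h ih =>
      intro hh s'
      have hh' : h < H := by omega
      refine ⟨?_, fun hne => ?_⟩
      · refine Finset.sum_congr rfl fun s _ => Finset.sum_congr rfl fun a _ => ?_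
        rw [eqm h hh' s (ih hh' s) a]
      · obtain ⟨s, -, hs⟩ := Finset.exists_ne_zero_of_sum_ne_zero hne
        obtain ⟨a, -, ha⟩ := Finset.exists_ne_zero_of_sum_ne_zero hs
        have h1 := (ih hh' s).2 (left_ne_zero_of_mul (left_ne_zero_of_mul ha))
        obtain ⟨a₀, hb, hπ'⟩ := hπ h hh' s h1
        have h2 := right_ne_zero_of_mul (left_ne_zero_of_mul ha)
        rw [(hπ' a).1] at h2
        obtain rfl := of_ind_ne_zero h2
        have h3 := of_ind_ne_zero (right_ne_zero_of_mul ha)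
        have nn : ∀ x b, 0 ≤ occ M β h x * β h x b * ind (M.step h x b = s') := fun x b =>
          mul_nonneg (mul_nonneg (occ_nonneg hβ M h x) (hβ.1 _ _ _)) (ind_nonneg _)
        refine Finset.sum_pos' (fun x _ => Finset.sum_nonneg fun b _ => nn x b)
          ⟨s, Finset.mem_univ s, Finset.sum_pos' (fun b _ => nn s b) ⟨a, Finset.mem_univ a, ?_⟩⟩
        rw [ind_of h3, mul_one]
        exact mul_pos h1 hb
  refine Finset.sum_congr rfl fun h hh => Finset.sum_congr rfl fun s _ =>
    Finset.sum_congr rfl fun a _ => ?_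
  have hh' := Finset.mem_range.mp hh
  rw [eqm h hh' s (main h hh' s) a]

/-- If the maximal return accounts for more than a `1 - α` fraction of the visits, then it is
the only empirical `α`-quantile. -/
lemma IsEmpQuantile.eq_fstar (M : DetMDP S A H) (β : Pol S A) {N : ℕ}
    {D : Fin N → Traj S A H} (hD : ∀ k, 0 < trajProb M β (D k)) {α q : ℝ} {s : S} {h : ℕ}
    (hq : IsEmpQuantile M D α s h q) (hα : α < 1) (hpos : 0 < ∑ k, ind (stAt (D k) h = s))
    (hfrac : (1 - α) * ∑ k, ind (stAt (D k) h = s) <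
      ∑ k, ind (stAt (D k) h = s ∧ rtg M h (D k) = fstar M β s h)) :
    q = fstar M β s h := by
  obtain ⟨h1, h2⟩ := hq
  refine le_antisymm (not_lt.mp fun hlt => ?_) (not_lt.mp fun hlt => ?_)
  · have : ∑ k, ind (stAt (D k) h = s ∧ q ≤ rtg M h (D k)) = 0 :=
      Finset.sum_eq_zero fun k _ => ind_of_not fun hc =>
        absurd (rtg_le_fstar M β (hD k) hc.1) (not_le.mpr (hlt.trans_le hc.2))
    rw [this] at h2
    exact absurd h2 (not_le.mpr (mul_pos (by linarith) hpos))
  · have : ∑ k, ind (stAt (D k) h = s ∧ rtg M h (D k) ≤ q) +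
        ∑ k, ind (stAt (D k) h = s ∧ rtg M h (D k) = fstar M β s h) ≤
        ∑ k, ind (stAt (D k) h = s) := by
      rw [← Finset.sum_add_distrib]
      refine Finset.sum_le_sum fun k _ => ?_
      by_cases hs : stAt (D k) h = s
      · by_cases hle : rtg M h (D k) ≤ q
        · rw [ind_of hs, ind_of ⟨hs, hle⟩, ind_of_not fun hc => by linarith [hc.2]]; simp
        · rw [ind_of hs, ind_of_not (P := _ ∧ _ ≤ q) fun hc => hle hc.2, zero_add]
          by_cases he : rtg M h (D k) = fstar M β s h
          · rw [ind_of ⟨hs, he⟩]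
          · rw [ind_of_not fun hc => he hc.2]; exact zero_le_one
      · rw [ind_of_not hs, ind_of_not fun hc => hs hc.1, ind_of_not fun hc => hs hc.1]; simp
    linarith

/-- A dataset is well covered if every visited state appears in it and shows its maximal
return in at least a `c / 2` fraction of its visits. -/
def WellCovered (M : DetMDP S A H) (β : Pol S A) (c : ℝ) {N : ℕ}
    (D : Fin N → Traj S A H) : Prop :=
  ∀ h, h < H → ∀ s, 0 < occ M β h s →
    0 < ∑ k, ind (stAt (D k) h = s) ∧
      c / 2 * ∑ k, ind (stAt (D k) h = s) ≤
        ∑ k, ind (stAt (D k) h = s ∧ rtg M h (D k) = fstar M β s h)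

lemma exists_traj_fstar {β : Pol S A} (M : DetMDP S A H)
    {h : ℕ} {s : S}
    (hpos : 0 < ∑ τ : Traj S A H,
      trajProb M β τ * ind (stAt τ h = s ∧ rtg M h τ = fstar M β s h))
    (hβ : IsPolicy β) :
    ∃ τ, 0 < trajProb M β τ ∧ stAt τ h = s ∧ rtg M h τ = fstar M β s h := by
  obtain ⟨τ, -, hτ⟩ := Finset.exists_ne_zero_of_sum_ne_zero hpos.ne'
  exact ⟨τ, lt_of_le_of_ne (trajProb_nonneg hβ M τ) (Ne.symm (left_ne_zero_of_mul hτ)),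
    of_ind_ne_zero (right_ne_zero_of_mul hτ)⟩

lemma J_eq_of_wellCovered (M : DetMDP S A H) {β : Pol S A} (hβ : IsPolicy β)
    (hnotie : ∀ h, h < H → ∀ τ1 τ2 : Traj S A H,
      0 < trajProb M β τ1 → 0 < trajProb M β τ2 →
      stAt τ1 h = stAt τ2 h → actAt τ1 h ≠ actAt τ2 h → rtg M h τ1 ≠ rtg M h τ2)
    {c : ℝ} (hc : 0 < c)
    (hcov : ∀ h, h < H → ∀ s : S, 0 < occ M β h s →
      c * occ M β h s ≤
        ∑ τ : Traj S A H, trajProb M β τ * ind (stAt τ h = s ∧ rtg M h τ = fstar M β s h))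
    {α : ℝ} (hα1 : 1 - c / 2 < α) (hα2 : α < 1) {N : ℕ} {D : Fin N → Traj S A H}
    (hD : ∀ k, 0 < trajProb M β (D k)) (f : S → ℕ → ℝ)
    (hf : ∀ s h, h < H → IsEmpQuantile M D α s h (f s h)) (hgood : WellCovered M β c D) :
    J M (piStar M β) = J M fun h s a => empCondPolicy M D h s (f s h) a := by
  refine J_congr hβ M _ _ fun h hh s hs => ?_
  have hpos := (mul_pos hc hs).trans_le (hcov h hh s hs)
  obtain ⟨τ, hτ, hτs, hτg⟩ := exists_traj_fstar M hpos hβ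
  obtain ⟨hn, hm⟩ := hgood h hh s hs
  have hfrac : (1 - α) * ∑ k, ind (stAt (D k) h = s) <
      ∑ k, ind (stAt (D k) h = s ∧ rtg M h (D k) = fstar M β s h) :=
    (mul_lt_mul_of_pos_right (by linarith) hn).trans_le hm
  have hq := (hf s h hh).eq_fstar M β hD hα2 hn hfrac
  refine ⟨actAt τ h, hτs ▸ policy_pos_of_trajProb_pos hβ M hτ hh, fun a => ⟨?_, ?_⟩⟩
  · exact cond_action_eq_ind M β (hnotie h hh) hτ hτs hτg (trajProb M β) id
      (fun i hi => lt_of_le_of_ne (trajProb_nonneg hβ M i) (Ne.symm hi)) hpos a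
  · have := cond_action_eq_ind M β (hnotie h hh) hτ hτs hτg (fun _ : Fin N => 1) D
      (fun k _ => hD k) (by
        simp only [one_mul]
        exact (mul_pos (by linarith) hn).trans hfrac) a
    simp only [one_mul] at this
    simp only [empCondPolicy, hq, this]

lemma exp_bernoulli_le {c : ℝ} (hc0 : 0 ≤ c) (hc1 : c ≤ 1) :
    Real.exp (c ^ 2 / 2) * (1 - c + c * Real.exp (-c)) ≤ 1 - c ^ 2 / 4 := by
  have h1 : Real.exp (-c) ≤ 1 - c + c ^ 2 / 2 - c ^ 3 / 6 + 5 * c ^ 4 / 96 := by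
    have := Real.exp_bound (x := -c) (by rw [abs_neg, abs_of_nonneg hc0]; exact hc1)
      (n := 4) (by norm_num)
    have := (abs_le.mp this).2
    rw [abs_neg, abs_of_nonneg hc0] at this
    norm_num [Finset.sum_range_succ, Nat.factorial] at this
    linarith
  have hc2 : c ^ 2 ≤ 1 := by nlinarith
  have h2 : 1 - c ^ 2 / 2 + c ^ 4 / 8 - c ^ 6 / 36 ≤ Real.exp (-(c ^ 2 / 2)) := by
    have := Real.exp_bound (x := -(c ^ 2 / 2))
      (by rw [abs_neg, abs_of_nonneg (by positivity)]; linarith) (n := 3) (by norm_num)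
    have := (abs_le.mp this).1
    rw [abs_neg, abs_of_nonneg (by positivity)] at this
    norm_num [Finset.sum_range_succ, Nat.factorial] at this
    linarith
  have h3 : 1 - c + c * Real.exp (-c) ≤ (1 - c ^ 2 / 4) * Real.exp (-(c ^ 2 / 2)) := by
    have a1 := mul_le_mul_of_nonneg_left h1 hc0
    have a2 := mul_le_mul_of_nonneg_left h2 (show 0 ≤ 1 - c ^ 2 / 4 by linarith)
    have key : 0 ≤ 1 / 4 - c / 2 + 5 * c ^ 2 / 12 - 5 * c ^ 3 / 96 - 17 * c ^ 4 / 288 := by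
      nlinarith [sq_nonneg (c - 3 / 4), mul_nonneg hc0 (sub_nonneg.mpr hc1),
        mul_nonneg (mul_nonneg hc0 hc0) (sub_nonneg.mpr hc1),
        mul_nonneg (mul_nonneg (mul_nonneg hc0 hc0) hc0) (sub_nonneg.mpr hc1)]
    nlinarith [mul_nonneg (sq_nonneg c) key, pow_nonneg hc0 8]
  calc _ ≤ Real.exp (c ^ 2 / 2) * ((1 - c ^ 2 / 4) * Real.exp (-(c ^ 2 / 2))) :=
        mul_le_mul_of_nonneg_left h3 (Real.exp_pos _).le
    _ = (1 - c ^ 2 / 4) * (Real.exp (c ^ 2 / 2) * Real.exp (-(c ^ 2 / 2))) := by ring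
    _ = 1 - c ^ 2 / 4 := by rw [← Real.exp_add]; simp

/-- Moment generating function bound for the deficit of `Q`-outcomes among `P`-outcomes. -/
lemma sum_mul_exp_le {Ω : Type*} [Fintype Ω] (p : Ω → ℝ) (hp : ∑ ω, p ω = 1)
    (P Q : Ω → Prop) {c d : ℝ} (hc0 : 0 ≤ c) (hc1 : c ≤ 1)
    (hd : ∑ ω, p ω * ind (P ω) = d) (hd0 : 0 ≤ d)
    (hm : c * d ≤ ∑ ω, p ω * ind (P ω ∧ Q ω)) :
    ∑ ω, p ω * Real.exp (c * (c / 2 * ind (P ω) - ind (P ω ∧ Q ω))) ≤ 1 - d * (c ^ 2 / 4) := by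
  have hpt : ∀ ω, p ω * Real.exp (c * (c / 2 * ind (P ω) - ind (P ω ∧ Q ω))) =
      p ω + (Real.exp (c ^ 2 / 2) - 1) * (p ω * ind (P ω)) -
        Real.exp (c ^ 2 / 2) * (1 - Real.exp (-c)) * (p ω * ind (P ω ∧ Q ω)) := by
    intro ω
    by_cases hP : P ω
    · by_cases hQ : Q ω
      · rw [ind_of hP, ind_of ⟨hP, hQ⟩,
          show c * (c / 2 * 1 - 1) = c ^ 2 / 2 + -c by ring, Real.exp_add]
        ring
      · rw [ind_of hP, ind_of_not fun h => hQ h.2,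
          show c * (c / 2 * 1 - 0) = c ^ 2 / 2 by ring]
        ring
    · rw [ind_of_not hP, ind_of_not fun h => hP h.1]
      simp
  simp only [hpt, Finset.sum_add_distrib, Finset.sum_sub_distrib, ← Finset.mul_sum, hp, hd]
  have h1 : 0 ≤ Real.exp (c ^ 2 / 2) * (1 - Real.exp (-c)) :=
    mul_nonneg (Real.exp_pos _).le (sub_nonneg.mpr (Real.exp_le_one_iff.mpr (by linarith)))
  have h2 := mul_le_mul_of_nonneg_left hm h1
  have h3 := mul_le_mul_of_nonneg_left (exp_bernoulli_le hc0 hc1) hd0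
  linarith

lemma pow_one_sub_le_exp {x L : ℝ} (hx : x ≤ 1) {N : ℕ} (hL : L ≤ N * x) :
    (1 - x) ^ N ≤ Real.exp (-L) := by
  calc (1 - x) ^ N ≤ Real.exp (-x) ^ N :=
        pow_le_pow_left₀ (by linarith) (by linarith [Real.add_one_le_exp (-x)]) N
    _ = Real.exp (-(N * x)) := by rw [← Real.exp_nat_mul]; ring_nf
    _ ≤ Real.exp (-L) := Real.exp_le_exp.mpr (by linarith)

/-- Nonnegative bound for the indicator that state `s` at stage `h` is badly covered. -/
noncomputable def badWeight (M : DetMDP S A H) (β : Pol S A) (c : ℝ) {N : ℕ} (h : ℕ) (s : S)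
    (D : Fin N → Traj S A H) : ℝ :=
  ∏ k, (1 - ind (stAt (D k) h = s)) +
    ∏ k, Real.exp (c * (c / 2 * ind (stAt (D k) h = s) -
      ind (stAt (D k) h = s ∧ rtg M h (D k) = fstar M β s h)))

lemma badWeight_nonneg (M : DetMDP S A H) (β : Pol S A) (c : ℝ) {N : ℕ} (h : ℕ) (s : S)
    (D : Fin N → Traj S A H) : 0 ≤ badWeight M β c h s D := by
  refine add_nonneg (Finset.prod_nonneg fun k _ => ?_)
    (Finset.prod_nonneg fun k _ => (Real.exp_pos _).le)
  by_cases hs : stAt (D k) h = s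
  · rw [ind_of hs]; simp
  · rw [ind_of_not hs]; simp

lemma one_le_badWeight (M : DetMDP S A H) (β : Pol S A) {c : ℝ} (hc : 0 ≤ c) {N : ℕ} {h : ℕ}
    {s : S} {D : Fin N → Traj S A H}
    (hbad : ¬ (0 < ∑ k, ind (stAt (D k) h = s) ∧
      c / 2 * ∑ k, ind (stAt (D k) h = s) ≤
        ∑ k, ind (stAt (D k) h = s ∧ rtg M h (D k) = fstar M β s h))) :
    1 ≤ badWeight M β c h s D := by
  unfold badWeight
  by_cases h0 : 0 < ∑ k, ind (stAt (D k) h = s)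
  · have h1 : ∑ k, ind (stAt (D k) h = s ∧ rtg M h (D k) = fstar M β s h) <
        c / 2 * ∑ k, ind (stAt (D k) h = s) := not_le.mp fun hle => hbad ⟨h0, hle⟩
    have h2 : 0 ≤ ∏ k, (1 - ind (stAt (D k) h = s)) := by
      refine Finset.prod_nonneg fun k _ => ?_
      by_cases hs : stAt (D k) h = s
      · rw [ind_of hs]; simp
      · rw [ind_of_not hs]; simp
    rw [← Real.exp_sum, ← Finset.mul_sum, Finset.sum_sub_distrib, ← Finset.mul_sum]
    have := Real.one_le_exp (mul_nonneg hc (sub_nonneg.mpr h1.le))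
    linarith
  · have h1 : ∀ k, ind (stAt (D k) h = s) = 0 := by
      have := (Finset.sum_eq_zero_iff_of_nonneg fun k _ => ind_nonneg _).mp
        (le_antisymm (not_lt.mp h0) (Finset.sum_nonneg fun k _ => ind_nonneg _))
      exact fun k => this k (Finset.mem_univ k)
    have h2 := Finset.prod_nonneg (s := Finset.univ) fun (k : Fin N) _ =>
      (Real.exp_pos (c * (c / 2 * ind (stAt (D k) h = s) -
        ind (stAt (D k) h = s ∧ rtg M h (D k) = fstar M β s h)))).le
    simpa [h1] using h2

lemma sum_badWeight_le (M : DetMDP S A H) {β : Pol S A} (hβ : IsPolicy β) {c d L : ℝ}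
    (hc : 0 < c) {h : ℕ} (hh : h < H) {s : S} (hs : 0 < occ M β h s)
    (hcov : c * occ M β h s ≤
      ∑ τ : Traj S A H, trajProb M β τ * ind (stAt τ h = s ∧ rtg M h τ = fstar M β s h))
    (hd : 0 < d) (hds : d ≤ occ M β h s) (hL : 0 ≤ L) {N : ℕ}
    (hN1 : 2 / d ^ 2 * L ≤ N) (hN2 : 4 / (c ^ 2 * d) * L ≤ N) :
    ∑ D : Fin N → Traj S A H, (∏ k, trajProb M β (D k)) * badWeight M β c h s D ≤
      2 * Real.exp (-L) := by
  have hocc := sum_trajProb_ind_stAt hβ M hh s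
  have hsum := sum_trajProb hβ M
  have hnn := trajProb_nonneg hβ M
  have hocc1 : occ M β h s ≤ 1 := by
    rw [← hocc, ← hsum]
    refine Finset.sum_le_sum fun τ _ => mul_le_of_le_one_right (hnn τ) ?_
    by_cases hs : stAt τ h = s
    · rw [ind_of hs]
    · rw [ind_of_not hs]; exact zero_le_one
  have hc1 : c ≤ 1 := by
    have : c * occ M β h s ≤ 1 * occ M β h s := by
      rw [one_mul]
      refine hcov.trans (hocc ▸ Finset.sum_le_sum fun τ _ =>
        mul_le_mul_of_nonneg_left ?_ (hnn τ))
      by_cases hs : stAt τ h = s ∧ rtg M h τ = fstar M β s h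
      · rw [ind_of hs, ind_of hs.1]
      · rw [ind_of_not hs]; exact ind_nonneg _
    exact le_of_mul_le_mul_right this hs
  have e1 : ∑ D : Fin N → Traj S A H, (∏ k, trajProb M β (D k)) * badWeight M β c h s D =
      (∑ τ, trajProb M β τ * (1 - ind (stAt τ h = s))) ^ N +
      (∑ τ, trajProb M β τ * Real.exp (c * (c / 2 * ind (stAt τ h = s) -
        ind (stAt τ h = s ∧ rtg M h τ = fstar M β s h)))) ^ N := by
    rw [Fintype.sum_pow, Fintype.sum_pow, ← Finset.sum_add_distrib]
    refine Finset.sum_congr rfl fun D _ => ?_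
    rw [badWeight, mul_add, Finset.prod_mul_distrib, Finset.prod_mul_distrib]
  have e2 : ∑ τ, trajProb M β τ * (1 - ind (stAt τ h = s)) = 1 - occ M β h s := by
    simp only [mul_sub, mul_one, Finset.sum_sub_distrib, hocc, hsum]
  have b1 : (1 - occ M β h s) ^ N ≤ Real.exp (-L) := by
    refine pow_one_sub_le_exp hocc1 ?_
    have hd1 : d ≤ 1 := hds.trans hocc1
    have : L ≤ 2 / d ^ 2 * L * d := by
      rw [show 2 / d ^ 2 * L * d = L * (2 / d) by field_simp]
      refine le_mul_of_one_le_right hL ?_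
      rw [le_div_iff₀ hd]; linarith
    calc L ≤ 2 / d ^ 2 * L * d := this
      _ ≤ N * occ M β h s := mul_le_mul hN1 hds hd.le (Nat.cast_nonneg N)
  have b2 : (∑ τ, trajProb M β τ * Real.exp (c * (c / 2 * ind (stAt τ h = s) -
        ind (stAt τ h = s ∧ rtg M h τ = fstar M β s h)))) ^ N ≤ Real.exp (-L) := by
    have hle := sum_mul_exp_le (trajProb M β) hsum (fun τ => stAt τ h = s)
      (fun τ => rtg M h τ = fstar M β s h) hc.le hc1 hocc hs.le hcov
    have hc2 : c ^ 2 / 4 ≤ 1 := by nlinarith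
    refine (pow_le_pow_left₀ (Finset.sum_nonneg fun τ _ =>
      mul_nonneg (hnn τ) (Real.exp_pos _).le) hle N).trans (pow_one_sub_le_exp ?_ ?_)
    · exact mul_le_one₀ hocc1 (by positivity) hc2
    · calc L = 4 / (c ^ 2 * d) * L * (d * (c ^ 2 / 4)) := by field_simp
        _ ≤ N * (occ M β h s * (c ^ 2 / 4)) :=
          mul_le_mul hN2 (mul_le_mul_of_nonneg_right hds (by positivity)) (by positivity)
            (Nat.cast_nonneg N)
  rw [e1, e2]
  linarith

/-- Union bound: a property implied by good coverage fails with probability at most the sum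
over stages and states of the bad-coverage bounds. -/
lemma one_sub_le_datasetProb (M : DetMDP S A H) {β : Pol S A} (hβ : IsPolicy β) {c B : ℝ}
    (hc : 0 ≤ c) (hB : 0 ≤ B) {N : ℕ}
    (hbad : ∀ h, h < H → ∀ s, 0 < occ M β h s →
      ∑ D : Fin N → Traj S A H, (∏ k, trajProb M β (D k)) * badWeight M β c h s D ≤ B)
    (E : (Fin N → Traj S A H) → Prop)
    (hE : ∀ D, (∀ k, 0 < trajProb M β (D k)) → WellCovered M β c D → E D) :
    1 - H * (Fintype.card S * B) ≤ datasetProb M β N E := by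
  have hnn := trajProb_nonneg hβ M
  have hPnn : ∀ D : Fin N → Traj S A H, 0 ≤ ∏ k, trajProb M β (D k) := fun D =>
    Finset.prod_nonneg fun k _ => hnn _
  have hone : ∑ D : Fin N → Traj S A H, ∏ k, trajProb M β (D k) = 1 := by
    rw [← Fintype.sum_pow, sum_trajProb hβ M, one_pow]
  have hpt : ∀ D : Fin N → Traj S A H, ∏ k, trajProb M β (D k) ≤
      (∏ k, trajProb M β (D k)) * ind (E D) + ∑ h ∈ Finset.range H, ∑ s,
        ind (0 < occ M β h s) * ((∏ k, trajProb M β (D k)) * badWeight M β c h s D) := by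
    intro D
    have hterm : ∀ h s, 0 ≤ ind (0 < occ M β h s) *
        ((∏ k, trajProb M β (D k)) * badWeight M β c h s D) := fun h s =>
      mul_nonneg (ind_nonneg _) (mul_nonneg (hPnn D) (badWeight_nonneg M β c h s D))
    have hdouble : 0 ≤ ∑ h ∈ Finset.range H, ∑ s, ind (0 < occ M β h s) *
        ((∏ k, trajProb M β (D k)) * badWeight M β c h s D) :=
      Finset.sum_nonneg fun h _ => Finset.sum_nonneg fun s _ => hterm h s
    by_cases hED : E D
    · rw [ind_of hED]; linarith
    by_cases h0 : ∃ k, trajProb M β (D k) = 0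
    · obtain ⟨k, hk⟩ := h0
      have : ∏ k, trajProb M β (D k) = 0 := Finset.prod_eq_zero (Finset.mem_univ k) hk
      simp [this]
    push Not at h0
    have hng : ¬ WellCovered M β c D := fun hg =>
      hED (hE D (fun k => lt_of_le_of_ne (hnn _) (Ne.symm (h0 k))) hg)
    unfold WellCovered at hng
    push Not at hng
    obtain ⟨h, hh, s, hs, hb⟩ := hng
    have hb1 : 1 ≤ badWeight M β c h s D :=
      one_le_badWeight M β hc fun hcon => absurd hcon.2 (not_le.mpr (hb hcon.1))
    rw [ind_of_not hED, mul_zero, zero_add]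
    calc ∏ k, trajProb M β (D k)
        ≤ ind (0 < occ M β h s) * ((∏ k, trajProb M β (D k)) * badWeight M β c h s D) := by
          rw [ind_of hs, one_mul]
          exact le_mul_of_one_le_right (hPnn D) hb1
      _ ≤ ∑ s, ind (0 < occ M β h s) *
            ((∏ k, trajProb M β (D k)) * badWeight M β c h s D) :=
          Finset.single_le_sum (f := fun s => ind (0 < occ M β h s) *
            ((∏ k, trajProb M β (D k)) * badWeight M β c h s D))
            (fun s _ => hterm h s) (Finset.mem_univ s)
      _ ≤ _ := Finset.single_le_sum (f := fun h => ∑ s, ind (0 < occ M β h s) *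
            ((∏ k, trajProb M β (D k)) * badWeight M β c h s D))
            (fun h _ => Finset.sum_nonneg fun s _ => hterm h s) (Finset.mem_range.mpr hh)
  have hsum := Finset.sum_le_sum fun D (_ : D ∈ Finset.univ) => hpt D
  rw [hone, Finset.sum_add_distrib] at hsum
  have hswap : ∑ D : Fin N → Traj S A H, ∑ h ∈ Finset.range H, ∑ s,
      ind (0 < occ M β h s) * ((∏ k, trajProb M β (D k)) * badWeight M β c h s D) ≤
      H * (Fintype.card S * B) := by
    rw [Finset.sum_comm]
    have : ∀ h ∈ Finset.range H, ∑ D : Fin N → Traj S A H, ∑ s,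
        ind (0 < occ M β h s) * ((∏ k, trajProb M β (D k)) * badWeight M β c h s D) ≤
        Fintype.card S * B := by
      intro h hh
      rw [Finset.sum_comm]
      refine (Finset.sum_le_card_nsmul _ _ B fun s _ => ?_).trans_eq (by simp)
      rw [← Finset.mul_sum]
      by_cases hs : 0 < occ M β h s
      · rw [ind_of hs, one_mul]
        exact hbad h (Finset.mem_range.mp hh) s hs
      · rw [ind_of_not hs, zero_mul]
        exact hB
    exact (Finset.sum_le_card_nsmul _ _ _ this).trans_eq (by simp)
  unfold datasetProb
  linarith

end Aux

end RCSL

namespace RCSL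

/-- (Reinforced RCSL with quantile regression finds the in-distribution
optimal stitched policy.)  In a finite deterministic episodic MDP with behavior policy `β`
satisfying the no-tie condition, with return coverage `P_β(g_h = f⋆(s,h) ∣ s_h = s) ≥ c̃` on
the support of `β`, with `d_min^β` a positive lower bound on the positive occupancies, and
with quantile level `α ∈ (1 − c̃/2, 1)`: if `f̂⋆(s, h)` is an empirical `α`-quantile of the
dataset stage-`h` returns at `s`, `π̂` is the empirical conditional action frequency, and
`π̂⋆_D(·∣s,h) = π̂(·∣s,h,f̂⋆(s,h))`, then once
`N ≥ max{(2/(d_min^β)²)·log(2SH/δ), (4/(c̃²·d_min^β))·log(2SH/δ)}`, with probability at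
least `1 − δ` over the dataset, `J(π⋆_β) = J(π̂⋆_D)`. -/
theorem stmt3 {S A : Type} [Fintype S] [Fintype A] [Nonempty S] [Nonempty A] {H : ℕ}
    (M : DetMDP S A H) (β : Pol S A) (hβ : IsPolicy β)
    (hnotie : ∀ h, h < H → ∀ τ1 τ2 : Traj S A H,
      0 < trajProb M β τ1 → 0 < trajProb M β τ2 →
      stAt τ1 h = stAt τ2 h → actAt τ1 h ≠ actAt τ2 h → rtg M h τ1 ≠ rtg M h τ2)
    (ctil : ℝ) (hctil : 0 < ctil)
    (hcov : ∀ h, h < H → ∀ s : S, 0 < occ M β h s →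
      ctil * occ M β h s ≤
        ∑ τ : Traj S A H, trajProb M β τ * ind (stAt τ h = s ∧ rtg M h τ = fstar M β s h))
    (dmin : ℝ) (hdmin : 0 < dmin)
    (hdm : ∀ h, h < H → ∀ s : S, 0 < occ M β h s → dmin ≤ occ M β h s)
    (α : ℝ) (hα1 : 1 - ctil / 2 < α) (hα2 : α < 1)
    (δ : ℝ) (hδ0 : 0 < δ) (hδ1 : δ < 1) (N : ℕ)
    (fhat : (Fin N → Traj S A H) → S → ℕ → ℝ)
    (hfhat : ∀ (D : Fin N → Traj S A H) (s : S) (h : ℕ), h < H →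
      IsEmpQuantile M D α s h (fhat D s h))
    (hN : max ((2 / dmin ^ 2) * Real.log (2 * Fintype.card S * H / δ))
        ((4 / (ctil ^ 2 * dmin)) * Real.log (2 * Fintype.card S * H / δ)) ≤ (N : ℝ)) :
    1 - δ ≤ datasetProb M β N fun D =>
      J M (piStar M β) = J M fun h s a => empCondPolicy M D h s (fhat D s h) a := by
  have hE : ∀ D : Fin N → Traj S A H, (∀ k, 0 < trajProb M β (D k)) → WellCovered M β ctil D →
      J M (piStar M β) = J M fun h s a => empCondPolicy M D h s (fhat D s h) a :=
    fun D hD hgood => J_eq_of_wellCovered M hβ hnotie hctil hcov hα1 hα2 hD (fhat D)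
      (hfhat D) hgood
  set L := Real.log (2 * Fintype.card S * H / δ) with hLdef
  have hfinal := one_sub_le_datasetProb M hβ hctil.le (B := 2 * Real.exp (-L)) (by positivity)
    (fun h hh s hs => ?_) _ hE
  · refine le_trans ?_ hfinal
    rcases Nat.eq_zero_or_pos H with hH | hH
    · simp [hH, hδ0.le]
    · have hS : (0 : ℝ) < Fintype.card S := by exact_mod_cast Fintype.card_pos
      have hH' : (0 : ℝ) < H := by exact_mod_cast hH
      rw [hLdef, Real.exp_neg, Real.exp_log (by positivity)]
      refine le_of_eq ?_
      field_simp
  · have hS : (1 : ℝ) ≤ Fintype.card S := by exact_mod_cast Fintype.card_pos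
    have hH : (1 : ℝ) ≤ H := by exact_mod_cast Nat.one_le_of_lt hh
    refine sum_badWeight_le M hβ hctil hh hs (hcov h hh s hs) hdmin (hdm h hh s hs)
      (Real.log_nonneg ?_) ((le_max_left _ _).trans hN) ((le_max_right _ _).trans hN)
    rw [le_div_iff₀ hδ0]
    nlinarith

end RCSL
end

section
/- In a finite deterministic episodic MDP with behavior policy β, for every feasible trajectory τ ∈ T_β and every stage h ∈ {1,…,H}, the label after H−1 relabeling passes satisfies g̃^{H−1}_h(τ) = Q_h^{⋆,β}(s_h(τ), a_h(τ)), where Q_h^{⋆,β}(s,a) = r_h(s,a) + V_{h+1}^{⋆,β}(P_h(s,a)) and V_{H+1}^{⋆,β} ≡ 0. -/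
open Finset

namespace RCSL

noncomputable section

variable {S A : Type} [Fintype S] [Fintype A] [Nonempty S] [Nonempty A] {H : ℕ}

/-- Value of policy `π` at stage `h` and state `s` when `n` steps remain. -/
def Vaux (M : DetMDP S A H) (π : Pol S A) : ℕ → ℕ → S → ℝ
  | 0, _, _ => 0
  | n + 1, h, s => ∑ a, π h s a * (M.r h s a + Vaux M π n (h + 1) (M.step h s a))

/-- The value function `V_h^π(s)`: expected total reward from stage `h` starting at `s`
under `π` (it vanishes for `h ≥ H`). -/
def V (M : DetMDP S A H) (π : Pol S A) (h : ℕ) (s : S) : ℝ :=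
  Vaux M π (H - h) h s

/-- The class `Π_β`: genuine policies whose action distributions are absolutely continuous
with respect to those of `β` at every state and stage. -/
def PolCovered (β π : Pol S A) : Prop :=
  IsPolicy π ∧ ∀ h s a, 0 < π h s a → 0 < β h s a

/-- The `β`-covered optimal value function `V_h^{⋆,β}(s) = max_{π ∈ Π_β} V_h^π(s)`. -/
def Vstar (M : DetMDP S A H) (β : Pol S A) (h : ℕ) (s : S) : ℝ :=
  sSup {v : ℝ | ∃ π : Pol S A, PolCovered β π ∧ V M π h s = v}

/-- The `β`-covered optimal Q-function
`Q_h^{⋆,β}(s, a) = r_h(s, a) + V_{h+1}^{⋆,β}(P_h(s, a))`. -/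
def Qstar (M : DetMDP S A H) (β : Pol S A) (h : ℕ) (s : S) (a : A) : ℝ :=
  M.r h s a + Vstar M β (h + 1) (M.step h s a)

/-- The multi-step relabeled return-to-go `g̃^k_h(τ)`: `g̃^0_h = g_h`, the label at the last
stage is carried over from the previous pass, and for `h + 1 < H` (1-indexed `h ≤ H - 1`),
`g̃^k_h(τ) = max{r_h + f⋆_{k-1}(s_{h+1}(τ), h+1), r_h + g̃^k_{h+1}(τ)}`, where
`f⋆_{k-1}(s, h) = max{g̃^{k-1}_h(τ') : τ' ∈ T_β, s_h(τ') = s}`. -/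
def gtilde (M : DetMDP S A H) (β : Pol S A) : ℕ → ℕ → Traj S A H → ℝ
  | 0, h, τ => rtg M h τ
  | k + 1, h, τ =>
    if h + 1 < H then
      max
        (M.r h (stAt τ h) (actAt τ h) +
          sSup {g : ℝ | ∃ τ' : Traj S A H, 0 < trajProb M β τ' ∧
            stAt τ' (h + 1) = stAt τ (h + 1) ∧ gtilde M β k (h + 1) τ' = g})
        (M.r h (stAt τ h) (actAt τ h) + gtilde M β (k + 1) (h + 1) τ)
    else gtilde M β k h τ
  termination_by k h _ => (k, H - h)
  decreasing_by
  · exact Prod.Lex.left _ _ (Nat.lt_succ_self k)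
  · exact Prod.Lex.right _ (by omega)
  · exact Prod.Lex.left _ _ (Nat.lt_succ_self k)

/-- The optimal `k`-pass-relabeled return-to-go `f⋆_k(s, h)`. -/
def fstark (M : DetMDP S A H) (β : Pol S A) (k : ℕ) (s : S) (h : ℕ) : ℝ :=
  sSup {g : ℝ | ∃ τ : Traj S A H, 0 < trajProb M β τ ∧ stAt τ h = s ∧ gtilde M β k h τ = g}

/-- The `k`-step reinforced RCSL policy
`π̃^{k,⋆}_β(a ∣ s, h) = P_β(a_h = a ∣ s_h = s, g̃^k_h = f⋆_k(s, h))`. -/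
def relabeledPolicy (M : DetMDP S A H) (β : Pol S A) (k : ℕ) : Pol S A :=
  fun h s a =>
    (∑ τ : Traj S A H, trajProb M β τ *
        ind (stAt τ h = s ∧ actAt τ h = a ∧ gtilde M β k h τ = fstark M β k s h)) /
      ∑ τ : Traj S A H, trajProb M β τ *
        ind (stAt τ h = s ∧ gtilde M β k h τ = fstark M β k s h)

end

end RCSL

namespace RCSL

noncomputable section

theorem IsPolicy.exists_pos {S A : Type} [Fintype A] {β : Pol S A} (hβ : IsPolicy β) (h : ℕ) (s : S) :
    ∃ a, 0 < β h s a := by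
  by_contra! hc
  have h0 : ∑ a, β h s a ≤ 0 := Finset.sum_nonpos fun a _ => hc a
  linarith [hβ.2 h s]

variable {S A : Type} [Fintype S] [Fintype A] {H : ℕ}

/-- The `β`-covered dynamic-programming value when `n` steps remain. -/
def bellmanValue (M : DetMDP S A H) (β : Pol S A) : ℕ → ℕ → S → ℝ
  | 0, _, _ => 0
  | n + 1, h, s => ⨆ a : {a // 0 < β h s a}, (M.r h s a + bellmanValue M β n (h + 1) (M.step h s a))

theorem le_bellmanValue_succ (M : DetMDP S A H) {β : Pol S A} (n : ℕ) {h : ℕ} {s : S} {a : A}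
    (ha : 0 < β h s a) :
    M.r h s a + bellmanValue M β n (h + 1) (M.step h s a) ≤ bellmanValue M β (n + 1) h s :=
  le_ciSup (f := fun a : {a // 0 < β h s a} =>
    M.r h s a + bellmanValue M β n (h + 1) (M.step h s a)) (Set.finite_range _).bddAbove ⟨a, ha⟩

theorem exists_eq_bellmanValue_succ (M : DetMDP S A H) {β : Pol S A} (hβ : IsPolicy β)
    (n h : ℕ) (s : S) :
    ∃ a, 0 < β h s a ∧
      M.r h s a + bellmanValue M β n (h + 1) (M.step h s a) = bellmanValue M β (n + 1) h s := by
  obtain ⟨b, hb⟩ := hβ.exists_pos h s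
  have : Nonempty {a // 0 < β h s a} := ⟨⟨b, hb⟩⟩
  obtain ⟨a, ha⟩ := exists_eq_ciSup_of_finite (f := fun a : {a // 0 < β h s a} =>
    M.r h s a + bellmanValue M β n (h + 1) (M.step h s a))
  exact ⟨a, a.2, ha⟩

theorem Vaux_le_bellmanValue (M : DetMDP S A H) {β π : Pol S A} (hπ : PolCovered β π) (n : ℕ) :
    ∀ h s, Vaux M π n h s ≤ bellmanValue M β n h s := by
  induction n with
  | zero => intro h s; simp [Vaux, bellmanValue]
  | succ n ih =>
    intro h s
    calc Vaux M π (n + 1) h s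
        ≤ ∑ a, π h s a * bellmanValue M β (n + 1) h s := by
          refine Finset.sum_le_sum fun a _ => ?_
          rcases (hπ.1.1 h s a).eq_or_lt with h0 | h0
          · simp [← h0]
          · refine mul_le_mul_of_nonneg_left ?_ h0.le
            linarith [ih (h + 1) (M.step h s a), le_bellmanValue_succ M n (hπ.2 h s a h0)]
      _ = bellmanValue M β (n + 1) h s := by rw [← Finset.sum_mul, hπ.1.2, one_mul]

theorem exists_Vaux_eq_bellmanValue (M : DetMDP S A H) {β : Pol S A} (hβ : IsPolicy β) :
    ∃ π, PolCovered β π ∧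
      ∀ n h s, n + h = H → Vaux M π n h s = bellmanValue M β n h s := by
  classical
  choose c hc hcv using fun h s => exists_eq_bellmanValue_succ M hβ (H - (h + 1)) h s
  refine ⟨fun h s a => if a = c h s then 1 else 0, ⟨⟨?_, ?_⟩, ?_⟩, ?_⟩
  · intro h s a
    positivity
  · intro h s
    simp
  · intro h s a ha
    by_cases hac : a = c h s
    · exact hac ▸ hc h s
    · simp [hac] at ha
  · intro n
    induction n with
    | zero => intro h s _; rfl
    | succ n ih =>
      intro h s hn
      have h1 := hcv h s
      rw [show H - (h + 1) = n by omega] at h1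
      simp only [Vaux, ite_mul, one_mul, zero_mul, Finset.sum_ite_eq', Finset.mem_univ, if_true]
      rw [ih (h + 1) _ (by omega), h1]

theorem Vstar_eq_bellmanValue (M : DetMDP S A H) {β : Pol S A} (hβ : IsPolicy β) {h : ℕ}
    (hh : h ≤ H) (s : S) : Vstar M β h s = bellmanValue M β (H - h) h s := by
  obtain ⟨π, hπ, hv⟩ := exists_Vaux_eq_bellmanValue M hβ
  refine IsGreatest.csSup_eq ⟨⟨π, hπ, hv _ _ _ (by omega)⟩, ?_⟩
  rintro v ⟨π', hπ', rfl⟩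
  exact Vaux_le_bellmanValue M hπ' _ _ _

theorem Qstar_le_Vstar (M : DetMDP S A H) {β : Pol S A} (hβ : IsPolicy β) {h : ℕ}
    (hh : h < H) {s : S} {a : A} (ha : 0 < β h s a) : Qstar M β h s a ≤ Vstar M β h s := by
  rw [Qstar, Vstar_eq_bellmanValue M hβ hh, Vstar_eq_bellmanValue M hβ hh.le,
    show H - h = H - (h + 1) + 1 by omega]
  exact le_bellmanValue_succ M _ ha

theorem exists_Qstar_eq_Vstar (M : DetMDP S A H) {β : Pol S A} (hβ : IsPolicy β) {h : ℕ}
    (hh : h < H) (s : S) : ∃ a, 0 < β h s a ∧ Qstar M β h s a = Vstar M β h s := by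
  obtain ⟨a, ha, hv⟩ := exists_eq_bellmanValue_succ M hβ (H - (h + 1)) h s
  refine ⟨a, ha, ?_⟩
  rw [Qstar, Vstar_eq_bellmanValue M hβ hh, Vstar_eq_bellmanValue M hβ hh.le,
    show H - h = H - (h + 1) + 1 by omega, hv]

theorem Vstar_horizon (M : DetMDP S A H) {β : Pol S A} (hβ : IsPolicy β) (s : S) :
    Vstar M β H s = 0 := by
  simp [Vstar_eq_bellmanValue M hβ le_rfl, bellmanValue]

variable [Nonempty S] [Nonempty A]

theorem trajProb_pos_iff (M : DetMDP S A H) {β : Pol S A} (hβ : IsPolicy β) (τ : Traj S A H) :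
    0 < trajProb M β τ ↔ (0 < H → 0 < M.ρ (stAt τ 0)) ∧
      (∀ h < H, 0 < β h (stAt τ h) (actAt τ h)) ∧
      ∀ h, h + 1 < H → stAt τ (h + 1) = M.step h (stAt τ h) (actAt τ h) := by
  constructor
  · intro hτ
    have hne := hτ.ne'
    simp only [trajProb, mul_ne_zero_iff, Finset.prod_ne_zero_iff, Finset.mem_univ,
      true_implies] at hne
    obtain ⟨⟨h1, h2⟩, h3⟩ := hne
    refine ⟨fun hH => ?_, fun h hh => ?_, fun h hh => ?_⟩
    · rw [if_pos hH] at h1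
      exact (M.ρ_nonneg _).lt_of_ne' h1
    · exact (hβ.1 _ _ _).lt_of_ne' (h2 ⟨h, hh⟩)
    · have := h3 ⟨h, by omega⟩
      by_contra hc
      simp [hh, ind, hc] at this
  · rintro ⟨h1, h2, h3⟩
    refine mul_pos (mul_pos ?_ ?_) ?_
    · split_ifs with hH
      · exact h1 hH
      · exact one_pos
    · exact Finset.prod_pos fun h _ => h2 h h.2
    · refine Finset.prod_pos fun h _ => ?_
      split_ifs with hh
      · simp [ind, h3 h hh]
      · exact one_pos

/-- A feasible trajectory can be cut at any stage `m` and continued feasibly with any action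
in the support of the behavior policy. -/
theorem exists_trajProb_pos_of_pos (M : DetMDP S A H) {β : Pol S A} (hβ : IsPolicy β)
    {τ : Traj S A H} (hτ : 0 < trajProb M β τ) {m : ℕ} (hm : m < H) {a : A}
    (ha : 0 < β m (stAt τ m) a) :
    ∃ τ' : Traj S A H, 0 < trajProb M β τ' ∧ stAt τ' m = stAt τ m ∧ actAt τ' m = a := by
  obtain ⟨h1, h2, h3⟩ := (trajProb_pos_iff M hβ τ).1 hτ
  choose d hd using hβ.exists_pos
  let c : ℕ → S → A := fun t s => if t < m then actAt τ t else if t = m then a else d t s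
  let σ : ℕ → S := fun t => Nat.rec (stAt τ 0) (fun t s => M.step t s (c t s)) t
  have hσ_succ : ∀ t, σ (t + 1) = M.step t (σ t) (c t (σ t)) := fun _ => rfl
  have hσ : ∀ t ≤ m, σ t = stAt τ t := by
    intro t
    induction t with
    | zero => intro _; rfl
    | succ t ih =>
      intro ht
      have hc : c t (stAt τ t) = actAt τ t := if_pos (by omega)
      rw [hσ_succ, ih (by omega), hc, h3 t (by omega)]
  let τ' : Traj S A H := fun i => (σ i, c i (σ i))
  have hst : ∀ t < H, stAt τ' t = σ t := fun t ht => by simp [stAt, ht, τ']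
  have hact : ∀ t < H, actAt τ' t = c t (σ t) := fun t ht => by simp [actAt, ht, τ']
  refine ⟨τ', (trajProb_pos_iff M hβ τ').2 ⟨fun hH => ?_, fun t ht => ?_, fun t ht => ?_⟩,
    ?_, ?_⟩
  · rw [hst 0 hH]
    exact h1 hH
  · rw [hst t ht, hact t ht]
    rcases lt_trichotomy t m with htm | rfl | htm
    · rw [hσ t htm.le, show c t (stAt τ t) = actAt τ t from if_pos htm]
      exact h2 t ht
    · rw [hσ t le_rfl, show c t (stAt τ t) = a by simp [c]]
      exact ha
    · rw [show c t (σ t) = d t (σ t) by simp [c, htm.not_gt, htm.ne']]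
      exact hd t _
  · rw [hst _ ht, hst t (by omega), hact t (by omega), hσ_succ]
  · rw [hst m hm, hσ m le_rfl]
  · simp [hact m hm, c]

theorem rtg_last (M : DetMDP S A H) {h : ℕ} (hh : h + 1 = H) (τ : Traj S A H) :
    rtg M h τ = M.r h (stAt τ h) (actAt τ h) := by
  rw [rtg, Finset.sum_eq_single (⟨h, by omega⟩ : Fin H)]
  · simp
  · intro t _ ht
    refine if_neg fun hle => ht (Fin.ext ?_)
    have := t.2
    simp only
    omega
  · simp

theorem gtilde_last (M : DetMDP S A H) (β : Pol S A) {h : ℕ} (hh : h + 1 = H) (k : ℕ)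
    (τ : Traj S A H) : gtilde M β k h τ = M.r h (stAt τ h) (actAt τ h) := by
  induction k with
  | zero => rw [gtilde, rtg_last M hh]
  | succ k ih => rw [gtilde, if_neg (by omega), ih]

/-- Labels with at most `k` later stages are optimal after `k` relabeling passes. -/
theorem gtilde_eq_Qstar (M : DetMDP S A H) {β : Pol S A} (hβ : IsPolicy β) (n : ℕ) :
    ∀ h k, n + (h + 1) = H → n ≤ k → ∀ τ : Traj S A H, 0 < trajProb M β τ →
      gtilde M β k h τ = Qstar M β h (stAt τ h) (actAt τ h) := by
  induction n with
  | zero =>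
    intro h k hn _ τ _
    rw [gtilde_last M β (by omega), Qstar, show h + 1 = H by omega, Vstar_horizon M hβ, add_zero]
  | succ n ih =>
    intro h k hn hk τ hτ
    obtain ⟨k, rfl⟩ : ∃ j, k = j + 1 := ⟨k - 1, by omega⟩
    have hh : h + 1 < H := by omega
    obtain ⟨_, hact, hstep⟩ := (trajProb_pos_iff M hβ τ).1 hτ
    have hsup : IsGreatest {g : ℝ | ∃ τ' : Traj S A H, 0 < trajProb M β τ' ∧
        stAt τ' (h + 1) = stAt τ (h + 1) ∧ gtilde M β k (h + 1) τ' = g}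
        (Vstar M β (h + 1) (stAt τ (h + 1))) := by
      constructor
      · obtain ⟨a, ha, hav⟩ := exists_Qstar_eq_Vstar M hβ hh (stAt τ (h + 1))
        obtain ⟨τ', hτ', hs, hact'⟩ := exists_trajProb_pos_of_pos M hβ hτ hh ha
        refine ⟨τ', hτ', hs, ?_⟩
        rw [ih (h + 1) k (by omega) (by omega) τ' hτ', hs, hact', hav]
      · rintro g ⟨τ', hτ', hs, rfl⟩
        rw [ih (h + 1) k (by omega) (by omega) τ' hτ', ← hs]
        exact Qstar_le_Vstar M hβ hh (((trajProb_pos_iff M hβ τ').1 hτ').2.1 _ hh)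
    rw [gtilde, if_pos hh, hsup.csSup_eq, ih (h + 1) (k + 1) (by omega) (by omega) τ hτ,
      max_eq_left (by linarith [Qstar_le_Vstar M hβ hh (hact _ hh)]), Qstar, hstep h hh]

end

/-- In a finite deterministic episodic MDP with behavior policy `β`, for
every feasible trajectory `τ ∈ T_β` and every stage `h`, the label after `H − 1` relabeling
passes satisfies `g̃^{H−1}_h(τ) = Q_h^{⋆,β}(s_h(τ), a_h(τ))`, where
`Q_h^{⋆,β}(s, a) = r_h(s, a) + V_{h+1}^{⋆,β}(P_h(s, a))` and `V` vanishes beyond the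
horizon. -/
theorem stmt5 {S A : Type} [Fintype S] [Fintype A] [Nonempty S] [Nonempty A] {H : ℕ}
    (M : DetMDP S A H) (β : Pol S A) (hβ : IsPolicy β)
    (τ : Traj S A H) (hτ : 0 < trajProb M β τ) (h : ℕ) (hh : h < H) :
    gtilde M β (H - 1) h τ = Qstar M β h (stAt τ h) (actAt τ h) :=
  gtilde_eq_Qstar M hβ (H - 1 - h) h (H - 1) (by omega) (by omega) τ hτ

end RCSL
end
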